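/- For every integer m ≥ 1 and every integer z, there exist n ≥ 1 and k ≥ 0 such that the coefficient of x^k in Φ_{mn}(x) equals z. That is, S(m) = { a(mn,k) : n ≥ 1, k ≥ 0 } = ℤ. -/

import Mathlib

open Polynomial

open ArithmeticFunction in
lemma aux_sum_bound (f : ℕ → ℝ) (P : ℕ → Prop) [DecidablePred P] (t : ℕ) (h0 : f 0 = 0)
    (hP : ∀ n, ¬ P n → f n = 0) (hf : ∀ n, f n ≤ Real.log n / n)
    (hc : ∀ k, ((Finset.Ico (2 ^ k) (2 ^ (k + 1))).filter P).card ≤ t) (n : ℕ) :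
    ∑ i ∈ Finset.range (2 ^ n), f i ≤ t * (4 - (2 * n + 4) / 2 ^ n) := by
  induction n with
  | zero => simp [h0]
  | succ n ih =>
    rw [Finset.range_eq_Ico, ← Finset.sum_Ico_consecutive f (Nat.zero_le (2 ^ n))
      (Nat.pow_le_pow_right (by norm_num) (Nat.le_succ n)), ← Finset.range_eq_Ico]
    have h1 : ∑ i ∈ Finset.Ico (2 ^ n) (2 ^ (n + 1)), f i ≤ t * ((n + 1) / 2 ^ n) := by
      rw [← Finset.sum_filter_of_ne (p := P) (fun i _ hi => by
        by_contra h; exact hi (hP i h))]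
      refine (Finset.sum_le_card_nsmul _ _ (((n : ℝ) + 1) / 2 ^ n) ?_).trans ?_
      · intro i hi
        simp only [Finset.mem_filter, Finset.mem_Ico] at hi
        obtain ⟨⟨ha, hb⟩, -⟩ := hi
        refine (hf i).trans ?_
        have ha_two : (2 : ℝ) ^ n ≤ i := by exact_mod_cast ha
        have hb_two : (i : ℝ) ≤ 2 ^ (n + 1) := by exact_mod_cast hb.le
        have hpos : (0 : ℝ) < 2 ^ n := by positivity
        have hlog : Real.log i ≤ n + 1 := by
          have := Real.log_le_log (hpos.trans_le ha_two) hb_two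
          rw [Real.log_pow] at this
          push_cast at this
          nlinarith [Real.log_two_lt_d9]
        exact div_le_div₀ (by positivity) hlog hpos ha_two
      · rw [nsmul_eq_mul]
        exact mul_le_mul_of_nonneg_right (by exact_mod_cast hc n) (by positivity)
    have h2 : (t : ℝ) * (4 - (2 * n + 4) / 2 ^ n) + t * ((n + 1) / 2 ^ n)
        = t * (4 - (2 * ((n + 1 : ℕ) : ℝ) + 4) / 2 ^ (n + 1)) := by
      push_cast
      rw [pow_succ]
      field_simp
      ring
    linarith

/-- Some dyadic interval contains at least `t` primes that are `1` modulo `m`. -/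
lemma exists_many_primes (m : ℕ) (hm : 1 ≤ m) (t : ℕ) : ∃ A : ℕ, ∃ S : Finset ℕ, S.card = t ∧
    ∀ p ∈ S, p.Prime ∧ p % m = 1 % m ∧ A ≤ p ∧ p < 2 * A := by
  have : NeZero m := ⟨by omega⟩
  by_contra hcon
  classical
  let P : ℕ → Prop := fun p => p.Prime ∧ (p : ZMod m) = 1
  have hc : ∀ k, ((Finset.Ico (2 ^ k) (2 ^ (k + 1))).filter P).card ≤ t := by
    intro k
    by_contra! h
    obtain ⟨S, hS, hcard⟩ := Finset.exists_subset_card_eq h.le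
    refine hcon ⟨2 ^ k, S, hcard, fun p hp => ?_⟩
    have := hS hp
    simp only [Finset.mem_filter, Finset.mem_Ico, P] at this
    refine ⟨this.2.1, ?_, this.1.1, by have := this.1.2; rw [pow_succ] at this; omega⟩
    have h3 : ((p : ℕ) : ZMod m) = ((1 : ℕ) : ZMod m) := by simpa using this.2.2
    exact (ZMod.natCast_eq_natCast_iff' _ _ _).1 h3
  apply ArithmeticFunction.vonMangoldt.not_summable_residueClass_prime_div
    (q := m) (a := 1) isUnit_one
  set f : ℕ → ℝ := fun n : ℕ ↦
    (if n.Prime then ArithmeticFunction.vonMangoldt.residueClass (1 : ZMod m) n else 0) / n with hf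
  have hnn : ∀ n, 0 ≤ f n := by
    intro n
    simp only [hf]
    refine div_nonneg ?_ n.cast_nonneg
    split_ifs
    exacts [ArithmeticFunction.vonMangoldt.residueClass_nonneg _ _, le_rfl]
  have hle : ∀ n, f n ≤ Real.log n / n := by
    intro n
    simp only [hf]
    refine div_le_div_of_nonneg_right ?_ n.cast_nonneg
    split_ifs
    · exact (ArithmeticFunction.vonMangoldt.residueClass_le _ _).trans
        ArithmeticFunction.vonMangoldt_le_log
    · exact Real.log_natCast_nonneg n
  have hz : ∀ n, ¬ P n → f n = 0 := by
    intro n hn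
    by_contra h
    have : n ∈ Function.support f := h
    rw [hf, ArithmeticFunction.vonMangoldt.support_residueClass_prime_div] at this
    exact hn this
  refine summable_of_sum_range_le (c := t * 4) hnn (fun n => ?_)
  have := aux_sum_bound f P t (by simp [hf]) hz hle hc n
  refine (Finset.sum_le_sum_of_subset_of_nonneg
    (Finset.range_mono (Nat.lt_two_pow_self (n := n)).le) (fun i _ _ => hnn i)).trans
    (this.trans ?_)
  refine mul_le_mul_of_nonneg_left ?_ t.cast_nonneg
  have : (0 : ℝ) ≤ (2 * n + 4) / 2 ^ n := by positivity
  linarith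

lemma exists_rank (S : Finset ℕ) : ∀ j, 1 ≤ j → j ≤ S.card →
    ∃ p ∈ S, (S.filter (· ≤ p)).card = j := by
  induction S using Finset.induction_on_max with
  | empty => intro j h1 h2; simp at h2; omega
  | insert a s ha ih =>
    intro j h1 h2
    have hn : a ∉ s := fun h => lt_irrefl _ (ha a h)
    rw [Finset.card_insert_of_notMem hn] at h2
    rcases Nat.lt_or_ge s.card j with h | h
    · refine ⟨a, Finset.mem_insert_self _ _, ?_⟩
      rw [Finset.filter_true_of_mem, Finset.card_insert_of_notMem hn]
      · omega
      · intro x hx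
        rcases Finset.mem_insert.1 hx with rfl | hx
        exacts [le_rfl, (ha x hx).le]
    · obtain ⟨p, hp, hpc⟩ := ih j h1 h
      refine ⟨p, Finset.mem_insert_of_mem hp, ?_⟩
      rw [Finset.filter_insert, if_neg (by have := ha p hp; omega), hpc]

lemma cyc_coeff_one_mul (n p : ℕ) (hn : 1 < n) (hp : p.Prime) (hd : ¬ p ∣ n) :
    (cyclotomic (n * p) ℤ).coeff 1 = - (cyclotomic n ℤ).coeff 1 := by
  have h := congrArg (fun q => q.coeff 1) (cyclotomic_expand_eq_cyclotomic_mul hp hd ℤ)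
  simp only [coeff_expand hp.pos, Nat.dvd_one, hp.ne_one, if_false] at h
  rw [Polynomial.mul_coeff_one, cyclotomic_coeff_zero ℤ hn,
    cyclotomic_coeff_zero ℤ (by nlinarith [hp.two_le])] at h
  linarith

lemma cyc_coeff_one (n : ℕ) : Squarefree n →
    n = 1 ∨ (1 < n ∧ ((cyclotomic n ℤ).coeff 1 = 1 ∨ (cyclotomic n ℤ).coeff 1 = -1)) := by
  induction n using induction_on_primes with
  | zero => intro h; simp at h
  | one => intro; left; rfl
  | prime_mul p a hp ih =>
    intro h
    right
    have ha := ih (h.of_mul_right)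
    rcases ha with rfl | ⟨h1, h2⟩
    · have := Fact.mk hp
      refine ⟨by simpa using hp.one_lt, Or.inl ?_⟩
      rw [mul_one, cyclotomic_prime]
      simp [coeff_X_pow, hp.one_lt]
    · have hd : ¬ p ∣ a := by
        intro hd
        exact hp.one_lt.ne' (Nat.isUnit_iff.1 (h p (mul_dvd_mul_left p hd)))
      refine ⟨by nlinarith [hp.two_le], ?_⟩
      rw [mul_comm, cyc_coeff_one_mul a p h1 hp hd]
      omega

lemma cyc_mul_mod (n p N : ℕ) (hn : 1 < n) (hp : p.Prime) (hd : ¬ p ∣ n) (hN : N ≤ 2 * p) :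
    (X : ℤ[X]) ^ N ∣ cyclotomic (n * p) ℤ * cyclotomic n ℤ
      - (1 + C ((cyclotomic n ℤ).coeff 1) * X ^ p) := by
  rw [← cyclotomic_expand_eq_cyclotomic_mul hp hd, X_pow_dvd_iff]
  intro d hdN
  simp only [coeff_sub, coeff_add, coeff_C_mul, coeff_X_pow, coeff_one, coeff_expand hp.pos]
  have hp0 := hp.pos
  by_cases h : p ∣ d
  · obtain ⟨c, rfl⟩ := h
    have : c < 2 := by
      by_contra! hc
      have := Nat.mul_le_mul_left p hc
      omega
    interval_cases c
    · simp [cyclotomic_coeff_zero ℤ hn, hp0.ne]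
    · simp [hp0, hp0.ne']
  · rw [if_neg h, if_neg (by rintro rfl; simp at h), if_neg (by rintro rfl; simp at h)]
    simp

lemma abstract_induct {R : Type*} [CommRing R] (F y : ℕ → R) (a : ℕ → ℤ) (m : ℕ) (hm : 1 < m)
    (S : Finset ℕ) (hS : ∀ p ∈ S, p.Prime ∧ ¬ p ∣ m)
    (hy : ∀ p ∈ S, ∀ q ∈ S, y p * y q = 0)
    (hF : ∀ n, 1 < n → ∀ p ∈ S, ¬ p ∣ n → F (n * p) * F n = 1 + (a n : R) * y p)
    (ha : ∀ n, 1 < n → ∀ p ∈ S, ¬ p ∣ n → a (n * p) = - a n) :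
    1 < m * ∏ p ∈ S, p ∧ a (m * ∏ p ∈ S, p) = (-1) ^ S.card * a m ∧
    (Even S.card → F (m * ∏ p ∈ S, p) = F m * (1 - (a m : R) * ∑ p ∈ S, y p)) ∧
    (Odd S.card → F (m * ∏ p ∈ S, p) * F m = 1 + (a m : R) * ∑ p ∈ S, y p) := by
  classical
  induction S using Finset.induction_on with
  | empty => simp [hm]
  | insert p s hps ih =>
    obtain ⟨i0, i1, i2, i3⟩ := ih (fun q hq => hS q (Finset.mem_insert_of_mem hq))
      (fun q hq r hr => hy q (Finset.mem_insert_of_mem hq) r (Finset.mem_insert_of_mem hr))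
      (fun n hn q hq => hF n hn q (Finset.mem_insert_of_mem hq))
      (fun n hn q hq => ha n hn q (Finset.mem_insert_of_mem hq))
    have hpS := Finset.mem_insert_self p s
    have hp := hS p hpS
    rw [Finset.prod_insert hps, Finset.sum_insert hps, Finset.card_insert_of_notMem hps,
      mul_comm p, ← mul_assoc]
    set n := m * ∏ q ∈ s, q with hn
    set Y := ∑ q ∈ s, y q with hY
    have hpn : ¬ p ∣ n := by
      intro h
      rcases hp.1.dvd_mul.1 h with h | h
      · exact hp.2 h
      · obtain ⟨q, hq, hpq⟩ := (hp.1.prime.dvd_finsetProd_iff _).1 h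
        have hq_two := (hS q (Finset.mem_insert_of_mem hq)).1
        rw [(Nat.prime_dvd_prime_iff_eq hp.1 hq_two).1 hpq] at hps
        exact hps hq
    have e1 := hF n i0 p hpS hpn
    have e2 := ha n i0 p hpS hpn
    have hyY : y p * Y = 0 := by
      rw [hY, Finset.mul_sum]
      exact Finset.sum_eq_zero fun q hq => hy p hpS q (Finset.mem_insert_of_mem hq)
    have hYY : Y * Y = 0 := by
      rw [hY, Finset.sum_mul_sum]
      exact Finset.sum_eq_zero fun q hq => Finset.sum_eq_zero fun r hr =>
        hy q (Finset.mem_insert_of_mem hq) r (Finset.mem_insert_of_mem hr)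
    refine ⟨by nlinarith [hp.1.two_le], by rw [e2, i1, pow_succ]; ring, fun h => ?_, fun h => ?_⟩
    · have ho : Odd s.card := by
        rw [Nat.even_add_one] at h; exact Nat.not_even_iff_odd.1 h
      have e3 := i3 ho
      rw [ho.neg_one_pow] at i1
      rw [i1] at e1
      push_cast at e1
      linear_combination F m * (1 - (a m : R) * Y) * e1 - F (n * p) * (1 - (a m : R) * Y) * e3 + (F (n * p) * (a m : R) ^ 2) * hYY + (F m * (a m : R) ^ 2) * hyY
    · have ho : Even s.card := by
        rw [Nat.odd_add_one] at h; exact Nat.not_odd_iff_even.1 h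
      have e3 := i2 ho
      rw [ho.neg_one_pow] at i1
      rw [i1] at e1
      push_cast at e1
      linear_combination (1 + (a m : R) * Y) * e1 - F (n * p) * (1 + (a m : R) * Y) * e3 + (F (n * p) * F m * (a m : R) ^ 2) * hYY + ((a m : R) ^ 2) * hyY

lemma inv_periodic (m : ℕ) (hm : 1 < m) : ∃ u : PowerSeries ℤ,
    (cyclotomic m ℤ : PowerSeries ℤ) * u = 1 ∧
    (∀ k, PowerSeries.coeff (m * k) u = 1) ∧
    (∀ k, PowerSeries.coeff (m * k + 1) u = - (cyclotomic m ℤ).coeff 1) := by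
  have hc0 := cyclotomic_coeff_zero ℤ hm
  have hu : IsUnit (cyclotomic m ℤ : PowerSeries ℤ) := by
    rw [PowerSeries.isUnit_iff_constantCoeff, ← PowerSeries.coeff_zero_eq_constantCoeff_apply,
      Polynomial.coeff_coe, hc0]
    exact isUnit_one
  obtain ⟨u, hu⟩ := hu.exists_right_inv
  have h0 : PowerSeries.coeff 0 u = 1 := by
    have := congrArg (PowerSeries.coeff 0) hu
    simpa [PowerSeries.coeff_mul, Polynomial.coeff_coe, hc0] using this
  have h1 : PowerSeries.coeff 1 u = - (cyclotomic m ℤ).coeff 1 := by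
    have := congrArg (PowerSeries.coeff 1) hu
    rw [PowerSeries.coeff_mul, Finset.Nat.sum_antidiagonal_eq_sum_range_succ_mk] at this
    simp [Finset.sum_range_succ, Polynomial.coeff_coe, hc0, PowerSeries.coeff_one] at this
    rw [← PowerSeries.coeff_zero_eq_constantCoeff_apply, h0] at this
    linarith
  obtain ⟨Q, hQ⟩ := cyclotomic.dvd_X_pow_sub_one m ℤ
  have hQ0 : Q ≠ 0 := by
    rintro rfl
    rw [mul_zero] at hQ
    exact (monic_X_pow_sub_C (1 : ℤ) (by omega : m ≠ 0)).ne_zero (by simpa using hQ)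
  have hdeg : Q.natDegree < m := by
    have h2 := congrArg natDegree hQ
    rw [natDegree_mul (cyclotomic_ne_zero m ℤ) hQ0, natDegree_cyclotomic] at h2
    have h3 : (X ^ m - 1 : ℤ[X]).natDegree = m := by
      simpa using natDegree_X_pow_sub_C (R := ℤ) (n := m) (r := 1)
    have := Nat.totient_pos.2 (by omega : 0 < m)
    omega
  have hper : ∀ k, PowerSeries.coeff (k + m) u = PowerSeries.coeff k u := by
    intro k
    have h2 : (PowerSeries.X ^ m - 1 : PowerSeries ℤ) * u = (Q : PowerSeries ℤ) := by
      have h3 : ((X ^ m - 1 : ℤ[X]) : PowerSeries ℤ) = (cyclotomic m ℤ * Q : ℤ[X]) := by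
        rw [← hQ]
      rw [Polynomial.coe_sub, Polynomial.coe_pow, Polynomial.coe_X, Polynomial.coe_one,
        Polynomial.coe_mul] at h3
      rw [h3]
      linear_combination (Q : PowerSeries ℤ) * hu
    have h4 := congrArg (PowerSeries.coeff (k + m)) h2
    rw [sub_mul, one_mul, map_sub, PowerSeries.coeff_X_pow_mul, Polynomial.coeff_coe,
      coeff_eq_zero_of_natDegree_lt (by omega)] at h4
    linarith
  refine ⟨u, hu, fun k => ?_, fun k => ?_⟩
  · induction k with
    | zero => simpa using h0
    | succ k ih => rw [mul_add, mul_one, hper, ih]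
  · induction k with
    | zero => simpa using h1
    | succ k ih => rw [show m * (k + 1) + 1 = m * k + 1 + m by ring, hper, ih]

lemma core (m : ℕ) (hm : 1 < m) (j : ℕ) (hj : 1 ≤ j) :
    ∃ n ≥ 1, ∃ k : ℕ, (cyclotomic (m * n) ℤ).coeff k
      = (cyclotomic m ℤ).coeff 1 * ((j : ℤ) - 1) := by
  obtain ⟨A, S, hcard, hS⟩ := exists_many_primes m hm.le (2 * j + 1)
  obtain ⟨p, hpS, hpc⟩ := exists_rank S j hj (by omega)
  have hmod : ∀ q ∈ S, q % m = 1 := fun q hq => by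
    rw [(hS q hq).2.1, Nat.mod_eq_of_lt hm]
  have hnd : ∀ q ∈ S, q.Prime ∧ ¬ q ∣ m := fun q hq => by
    refine ⟨(hS q hq).1, fun hd => ?_⟩
    have h1 := hmod q hq
    have h2 := Nat.le_of_dvd (by omega) hd
    rcases h2.eq_or_lt with h | h
    · rw [h, Nat.mod_self] at h1; omega
    · rw [Nat.mod_eq_of_lt h] at h1
      exact (hS q hq).1.one_lt.ne' h1
  set e := (cyclotomic m ℤ).coeff 1 with he
  let I : Ideal ℤ[X] := Ideal.span {(X : ℤ[X]) ^ (2 * A)}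
  let f := Ideal.Quotient.mk I
  have hf : ∀ a b : ℤ[X], f a = f b ↔ (X : ℤ[X]) ^ (2 * A) ∣ a - b := fun a b => by
    rw [Ideal.Quotient.eq, Ideal.mem_span_singleton]
  have key := abstract_induct (fun n => f (cyclotomic n ℤ)) (fun q => f (X ^ q))
    (fun n => (cyclotomic n ℤ).coeff 1) m hm S hnd
    (fun q hq r hr => by
      have h1 := (hS q hq).2.2.1
      have h2 := (hS r hr).2.2.1
      rw [← map_mul, ← map_zero f, hf, sub_zero, ← pow_add]
      exact pow_dvd_pow _ (by omega))
    (fun n hn q hq hqn => by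
      have h1 := (hS q hq).2.2.1
      have := (hf _ _).2 (cyc_mul_mod n q (2 * A) hn (hS q hq).1 hqn (by omega))
      simpa using this)
    (fun n hn q hq hqn => cyc_coeff_one_mul n q hn (hS q hq).1 hqn)
  obtain ⟨h0, -, -, h3⟩ := key
  have h4 := h3 (by rw [hcard]; exact ⟨j, rfl⟩)
  refine ⟨∏ q ∈ S, q, Finset.prod_pos fun q hq => (hS q hq).1.pos, p, ?_⟩
  set n := m * ∏ q ∈ S, q
  have h5 : f (cyclotomic n ℤ * cyclotomic m ℤ) = f (1 + C e * ∑ q ∈ S, X ^ q) := by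
    rw [map_mul, h4, map_add, map_one, map_mul, map_sum]
    congr 2
  obtain ⟨H, hH⟩ := (hf _ _).1 h5
  obtain ⟨u, hu, hu0, hu1⟩ := inv_periodic m hm
  have h6 : (cyclotomic n ℤ : PowerSeries ℤ) * (cyclotomic m ℤ : PowerSeries ℤ) =
      1 + PowerSeries.C e * ∑ q ∈ S, PowerSeries.X ^ q
        + PowerSeries.X ^ (2 * A) * (H : PowerSeries ℤ) := by
    have h7 := congrArg (Polynomial.coeToPowerSeries.ringHom (R := ℤ))
      (sub_eq_iff_eq_add'.1 hH)
    rw [map_add, map_add, map_mul, map_mul, map_mul, map_sum] at h7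
    simpa only [map_one, map_pow, Polynomial.coeToPowerSeries.ringHom_apply, Polynomial.coe_C,
      Polynomial.coe_X, Polynomial.coe_pow] using h7
  have h7 : (cyclotomic n ℤ : PowerSeries ℤ) =
      u + PowerSeries.C e * ∑ q ∈ S, PowerSeries.X ^ q * u
        + PowerSeries.X ^ (2 * A) * ((H : PowerSeries ℤ) * u) := by
    rw [← Finset.sum_mul]
    linear_combination u * h6 - (cyclotomic n ℤ : PowerSeries ℤ) * hu
  have h8 := congrArg (PowerSeries.coeff p) h7
  have hp2 := (hS p hpS).2.2.2
  have hpm : p = m * (p / m) + 1 := by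
    have := Nat.div_add_mod p m
    rw [hmod p hpS] at this
    exact this.symm
  have hup : PowerSeries.coeff p u = - e := by rw [hpm, hu1]
  have hsum : ∑ q ∈ S, PowerSeries.coeff p (PowerSeries.X ^ q * u) = (j : ℤ) := by
    rw [← hpc, Finset.card_filter]
    push_cast
    refine Finset.sum_congr rfl fun q hq => ?_
    rw [PowerSeries.coeff_X_pow_mul']
    split_ifs with hqp
    · have hd : m ∣ p - q := (Nat.modEq_iff_dvd' hqp).1 (by
        rw [Nat.ModEq, hmod q hq, hmod p hpS])
      obtain ⟨c, hc⟩ := hd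
      rw [hc, hu0]
    · rfl
  rw [Polynomial.coeff_coe, map_add, map_add, PowerSeries.coeff_C_mul, map_sum, hsum, hup,
    PowerSeries.coeff_X_pow_mul', if_neg (by omega)] at h8
  rw [h8]
  ring

lemma sqfree_case (m : ℕ) (hm : Squarefree m) (z : ℤ) :
    ∃ n ≥ 1, ∃ k : ℕ, (cyclotomic (m * n) ℤ).coeff k = z := by
  have hm0 : 0 < m := Nat.pos_of_ne_zero hm.ne_zero
  -- a multiple of `m` whose linear coefficient has any prescribed sign
  have hsign : ∀ s : ℤ, (s = 1 ∨ s = -1) → ∃ r ≥ 1, 1 < m * r ∧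
      (cyclotomic (m * r) ℤ).coeff 1 = s := by
    intro s hs
    obtain ⟨q, hq, hqp⟩ := Nat.exists_infinite_primes (m + 1)
    obtain ⟨q_two, hq_two, hqp_two⟩ := Nat.exists_infinite_primes (m * q + 1)
    have hqd : ¬ q ∣ m := fun h => by have := Nat.le_of_dvd hm0 h; omega
    have h1 : 1 < m * q := by nlinarith [hqp.two_le]
    have hqd_two : ¬ q_two ∣ m * q := fun h => by have := Nat.le_of_dvd (by omega) h; omega
    have hsq : Squarefree (m * q) :=
      (Nat.squarefree_mul ((hqp.coprime_iff_not_dvd.2 hqd).symm)).2 ⟨hm, hqp.prime.squarefree⟩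
    have h2 := cyc_coeff_one_mul (m * q) q_two h1 hqp_two hqd_two
    by_cases hc : (cyclotomic (m * q) ℤ).coeff 1 = s
    · exact ⟨q, hqp.pos, h1, hc⟩
    · refine ⟨q * q_two, Nat.mul_pos hqp.pos hqp_two.pos, ?_, ?_⟩
      · rw [← mul_assoc]; nlinarith [hqp_two.two_le]
      · rw [← mul_assoc, h2]
        rcases cyc_coeff_one _ hsq with h | ⟨-, h⟩ <;> omega
  obtain ⟨s, hs, hz⟩ : ∃ s : ℤ, (s = 1 ∨ s = -1) ∧ z = s * z.natAbs := by
    rcases le_total 0 z with h | h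
    · exact ⟨1, Or.inl rfl, by omega⟩
    · exact ⟨-1, Or.inr rfl, by omega⟩
  obtain ⟨r, hr, hr1, hrs⟩ := hsign s hs
  obtain ⟨n, hn, k, hk⟩ := core (m * r) hr1 (z.natAbs + 1) (by omega)
  refine ⟨r * n, Nat.mul_pos hr hn, k, ?_⟩
  rw [← mul_assoc, hk, hrs, Nat.cast_add, Nat.cast_one, add_sub_cancel_right]
  exact hz.symm

/-- Every integer occurs as a coefficient of some cyclotomic polynomial `Φ_{mn}`:
`S(m) = ℤ` for every `m ≥ 1`. -/
theorem cyclotomic_coeff_surjective (m : ℕ) (hm : 1 ≤ m) (z : ℤ) :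
    ∃ n ≥ 1, ∃ k : ℕ, (cyclotomic (m * n) ℤ).coeff k = z := by
  induction m using Nat.strong_induction_on with
  | _ m ih =>
    by_cases hs : Squarefree m
    · exact sqfree_case m hs z
    · rw [Nat.squarefree_iff_prime_squarefree] at hs
      push Not at hs
      obtain ⟨p, hp, c, hc⟩ := hs
      have hpos : 0 < p * c := by
        rcases Nat.eq_zero_or_pos (p * c) with h | h
        · rw [mul_assoc, h] at hc; omega
        · exact h
      obtain ⟨n, hn, k, hk⟩ := ih (p * c) (by rw [hc, mul_assoc]; nlinarith [hp.two_le]) hpos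
      refine ⟨n, hn, k * p, ?_⟩
      have := cyclotomic_expand_eq_cyclotomic hp
        (Dvd.intro (c * n) (by ring) : p ∣ p * c * n) ℤ
      rw [show m * n = p * c * n * p by rw [hc]; ring, ← this, coeff_expand_mul hp.pos, hk]
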